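/- arXiv:1910.06839 — 2 statements merged into one kernel-verified Lean document; each statement's English description precedes it below -/
import Mathlib

section
/- Let Q_0 ⊂ ℝ^n be a cube, f ∈ L^1(Q_0), and w ∈ A_∞^d(Q_0) with constants C_w, δ_w > 0. Then there exist a constant ρ = ρ(C_w, δ_w) > 1 with C_w ρ^{−δ_w} < 1 and a collection S ⊂ D(Q_0) of dyadic cubes with Q_0 ∈ S such that: (a) whenever Q ∈ D(Q_0) satisfies π_S Q = S, then |Q|^{-1}∫_Q |f − f_S| dx ≤ ρ |S|^{-1}∫_S |f − f_S| dx; and (b) for every S ∈ S, Σ_{S' ∈ ch_S(S)} w(S') ≤ C_w ρ^{−δ_w} w(S) < w(S). -/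
open MeasureTheory ENNReal NNReal Set

noncomputable section

/-- Euclidean space `ℝ^n`. -/
abbrev Rn (n : ℕ) := EuclideanSpace ℝ (Fin n)

/-- The half-open cube with lower corner `a` and side length `l`:
`Q = [a₁, a₁+l) × … × [aₙ, aₙ+l)`. -/
def Cube {n : ℕ} (a : Rn n) (l : ℝ) : Set (Rn n) :=
  {x | ∀ i, a i ≤ x i ∧ x i < a i + l}

/-- `IsDyadicSub a l Q` : `Q` belongs to the collection `D(Q₀)` of dyadic subcubes of the cube
`Q₀ = Cube a l`, i.e. `Q₀` together with all cubes obtained from `Q₀` by recursively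
bisecting each edge. -/
def IsDyadicSub {n : ℕ} (a : Rn n) (l : ℝ) (Q : Set (Rn n)) : Prop :=
  ∃ (k : ℕ) (m : Fin n → ℕ), (∀ i, m i < 2 ^ k) ∧
    Q = {x : Rn n | ∀ i, a i + l * m i / 2 ^ k ≤ x i ∧ x i < a i + l * m i / 2 ^ k + l / 2 ^ k}

/-- The weighted measure `w(E) = ∫_E w dx` of a set, as an extended nonnegative real. -/
def wMass {n : ℕ} (w : Rn n → ℝ) (E : Set (Rn n)) : ℝ≥0∞ :=
  ∫⁻ x in E, ENNReal.ofReal (w x)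

/-- The dyadic Muckenhoupt `A_∞` condition on `Q₀ = Cube a l` with constants `Cw, δw`:
`w(E) ≤ Cw (|E|/|Q|)^δw w(Q)` for all dyadic `Q ∈ D(Q₀)` and all measurable `E ⊆ Q`. -/
def IsAinftyD {n : ℕ} (a : Rn n) (l : ℝ) (w : Rn n → ℝ) (Cw δw : ℝ) : Prop :=
  ∀ Q : Set (Rn n), IsDyadicSub a l Q → ∀ E : Set (Rn n), MeasurableSet E → E ⊆ Q →
    wMass w E ≤ ENNReal.ofReal Cw * (volume E / volume Q) ^ δw * wMass w Q

/-- `IsMinimalOver 𝒮 Q S` : `S = π_𝒮 Q`, i.e. `S` is the minimal cube of the collection `𝒮`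
containing `Q`. -/
def IsMinimalOver {n : ℕ} (𝒮 : Set (Set (Rn n))) (Q S : Set (Rn n)) : Prop :=
  S ∈ 𝒮 ∧ Q ⊆ S ∧ ∀ S' ∈ 𝒮, Q ⊆ S' → S ⊆ S'

/-- `IsSChild 𝒮 S S'` : `S' ∈ ch_𝒮(S)`, i.e. `S'` is a maximal cube of `𝒮` strictly
contained in `S`. -/
def IsSChild {n : ℕ} (𝒮 : Set (Set (Rn n))) (S S' : Set (Rn n)) : Prop :=
  S' ∈ 𝒮 ∧ S' ⊂ S ∧ ∀ S'' ∈ 𝒮, S' ⊆ S'' → S'' ⊂ S → S'' = S'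

/-! ### Nested families and iterated selection -/

/-- The collection generated from `Q₀` by iterating the selection relation `M`. -/
inductive Selected {α : Type*} (M : Set α → Set α → Prop) (Q₀ : Set α) : Set α → Prop
  | base : Selected M Q₀ Q₀
  | step {S T : Set α} : Selected M Q₀ S → M S T → Selected M Q₀ T

section Selection

variable {α : Type*} {M : Set α → Set α → Prop} {D : Set (Set α)} {Q₀ : Set α}

theorem Selected.mem (hQ₀ : Q₀ ∈ D) (hMD : ∀ S T, M S T → T ∈ D) {S : Set α}
    (hS : Selected M Q₀ S) : S ∈ D := by
  cases hS with
  | base => exact hQ₀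
  | step _ h => exact hMD _ _ h

/-- If every strict inclusion of `P` into a selected set passes through a set selected from the
latter, then every selected set strictly inside `P` lies in a set selected from `P`. -/
theorem Selected.exists_of_ssubset_aux (hQ₀ : Q₀ ∈ D) (hD₀ : ∀ S ∈ D, S ⊆ Q₀)
    (hMD : ∀ S T, M S T → T ∈ D) (hMs : ∀ S T, M S T → T ⊂ S)
    (hMmax : ∀ S T T', M S T → M S T' → T ⊆ T' → T = T')
    (hnest : ∀ S ∈ D, ∀ T ∈ D, ∀ R ∈ D, R ⊆ S → R ⊆ T → S ⊆ T ∨ T ⊆ S)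
    {P : Set α} (hP : Selected M Q₀ P)
    (hC : ∀ S, Selected M Q₀ S → P ⊂ S → ∃ S', M S S' ∧ P ⊆ S')
    {S : Set α} (hS : Selected M Q₀ S) : S ⊂ P → ∃ S', M P S' ∧ S ⊆ S' := by
  induction hS with
  | base => exact fun h => absurd (hD₀ P (hP.mem hQ₀ hMD)) h.not_subset
  | @step R S hR hRS ih =>
    intro hSP
    rcases hnest R (hR.mem hQ₀ hMD) P (hP.mem hQ₀ hMD) S (hMD _ _ hRS)
      (hMs _ _ hRS).subset hSP.subset with h | h
    · rcases h.eq_or_ssubset with rfl | h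
      · exact ⟨S, hRS, subset_rfl⟩
      · obtain ⟨S', h₁, h₂⟩ := ih h
        exact ⟨S', h₁, (hMs _ _ hRS).subset.trans h₂⟩
    · rcases h.eq_or_ssubset with rfl | h
      · exact ⟨S, hRS, subset_rfl⟩
      · obtain ⟨S', h₁, h₂⟩ := hC R hR h
        have := hMmax _ _ _ hRS h₁ (hSP.subset.trans h₂)
        exact absurd (this ▸ h₂) hSP.not_subset

/-- A selected set strictly inside a selected set `S` lies in a set selected directly from `S`. -/
theorem Selected.exists_of_ssubset (hQ₀ : Q₀ ∈ D) (hD₀ : ∀ S ∈ D, S ⊆ Q₀)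
    (hMD : ∀ S T, M S T → T ∈ D) (hMs : ∀ S T, M S T → T ⊂ S)
    (hMmax : ∀ S T T', M S T → M S T' → T ⊆ T' → T = T')
    (hnest : ∀ S ∈ D, ∀ T ∈ D, ∀ R ∈ D, R ⊆ S → R ⊆ T → S ⊆ T ∨ T ⊆ S)
    {T : Set α} (hT : Selected M Q₀ T) :
    ∀ S, Selected M Q₀ S → T ⊂ S → ∃ S', M S S' ∧ T ⊆ S' := by
  induction hT with
  | base => exact fun S hS h => absurd (hD₀ S (hS.mem hQ₀ hMD)) h.not_subset
  | @step P T hP hPT ih =>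
    intro S hS hTS
    rcases hnest P (hP.mem hQ₀ hMD) S (hS.mem hQ₀ hMD) T (hMD _ _ hPT)
      (hMs _ _ hPT).subset hTS.subset with h | h
    · rcases h.eq_or_ssubset with rfl | h
      · exact ⟨T, hPT, subset_rfl⟩
      · obtain ⟨S', h₁, h₂⟩ := ih S hS h
        exact ⟨S', h₁, (hMs _ _ hPT).subset.trans h₂⟩
    · rcases h.eq_or_ssubset with rfl | h
      · exact ⟨T, hPT, subset_rfl⟩
      · obtain ⟨S', h₁, h₂⟩ :=
          Selected.exists_of_ssubset_aux hQ₀ hD₀ hMD hMs hMmax hnest hP ih hS h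
        have := hMmax _ _ _ hPT h₁ (hTS.subset.trans h₂)
        exact absurd (this ▸ h₂) hTS.not_subset

end Selection

/-! ### Dyadic cubes -/

section Dyadic

variable {n : ℕ}

/-- The dyadic subcube of `Cube a l` of generation `k` and position `m`. -/
def dyadicCube (a : Rn n) (l : ℝ) (k : ℕ) (m : Fin n → ℕ) : Set (Rn n) :=
  {x : Rn n | ∀ i, a i + l * m i / 2 ^ k ≤ x i ∧ x i < a i + l * m i / 2 ^ k + l / 2 ^ k}

theorem dyadicCube_subset_of_le {a : Rn n} {l : ℝ} (hl : 0 < l) {k k' : ℕ} (hk : k ≤ k')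
    {m m' : Fin n → ℕ} {x : Rn n} (hx : x ∈ dyadicCube a l k m)
    (hx' : x ∈ dyadicCube a l k' m') : dyadicCube a l k' m' ⊆ dyadicCube a l k m := by
  obtain ⟨d, rfl⟩ := Nat.exists_eq_add_of_le hk
  intro y hy i
  obtain ⟨h₁, h₂⟩ := hx i
  obtain ⟨h₁', h₂'⟩ := hx' i
  obtain ⟨hy₁, hy₂⟩ := hy i
  obtain ⟨h, hh, rfl⟩ : ∃ h : ℝ, 0 < h ∧ l = h * 2 ^ (k + d) :=
    ⟨l / 2 ^ (k + d), by positivity, by field_simp⟩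
  have e₁ : h * 2 ^ (k + d) * (m i : ℝ) / 2 ^ k = h * ((m i * 2 ^ d : ℕ) : ℝ) := by
    push_cast; rw [pow_add]; field_simp
  have e₂ : h * 2 ^ (k + d) / 2 ^ k = h * ((2 ^ d : ℕ) : ℝ) := by
    push_cast; rw [pow_add]; field_simp
  have e₃ : h * 2 ^ (k + d) * (m' i : ℝ) / 2 ^ (k + d) = h * m' i := by field_simp
  have e₄ : h * 2 ^ (k + d) / 2 ^ (k + d) = h := by field_simp
  rw [e₁] at h₁ h₂ ⊢
  rw [e₂] at h₂ ⊢
  rw [e₃] at h₁' h₂' hy₁ hy₂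
  rw [e₄] at h₂' hy₂
  have l₁ : m i * 2 ^ d < m' i + 1 := by
    have : h * ((m i * 2 ^ d : ℕ) : ℝ) < h * ((m' i + 1 : ℕ) : ℝ) := by
      push_cast at h₁ ⊢; linarith
    exact_mod_cast lt_of_mul_lt_mul_left this hh.le
  have l₂ : m' i < m i * 2 ^ d + 2 ^ d := by
    have : h * (m' i : ℝ) < h * ((m i * 2 ^ d + 2 ^ d : ℕ) : ℝ) := by
      push_cast at h₂ ⊢; linarith
    exact_mod_cast lt_of_mul_lt_mul_left this hh.le
  have l₁' : h * ((m i * 2 ^ d : ℕ) : ℝ) ≤ h * (m' i : ℝ) :=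
    mul_le_mul_of_nonneg_left (by exact_mod_cast Nat.lt_succ_iff.mp l₁) hh.le
  have l₂' : h * ((m' i + 1 : ℕ) : ℝ) ≤ h * ((m i * 2 ^ d + 2 ^ d : ℕ) : ℝ) :=
    mul_le_mul_of_nonneg_left (by exact_mod_cast l₂) hh.le
  push_cast at l₁' l₂' ⊢
  constructor <;> linarith

theorem dyadicCube_zero (a : Rn n) (l : ℝ) : dyadicCube a l 0 (fun _ => 0) = Cube a l := by
  simp [dyadicCube, Cube]

theorem isDyadicSub_cube (a : Rn n) (l : ℝ) : IsDyadicSub a l (Cube a l) :=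
  ⟨0, fun _ => 0, by simp, (dyadicCube_zero a l).symm⟩

theorem dyadicCube_eq_preimage (a : Rn n) (l : ℝ) (k : ℕ) (m : Fin n → ℕ) :
    dyadicCube a l k m = (WithLp.ofLp : Rn n → Fin n → ℝ) ⁻¹'
      (Set.univ.pi fun i => Ico (a i + l * m i / 2 ^ k) (a i + l * m i / 2 ^ k + l / 2 ^ k)) := by
  ext x
  simp [dyadicCube, Set.mem_pi]

theorem measurableSet_dyadicCube (a : Rn n) (l : ℝ) (k : ℕ) (m : Fin n → ℕ) :
    MeasurableSet (dyadicCube a l k m) := by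
  rw [dyadicCube_eq_preimage]
  exact (PiLp.volume_preserving_ofLp (Fin n)).measurable
    (MeasurableSet.univ_pi fun i => measurableSet_Ico)

theorem volume_dyadicCube (a : Rn n) (l : ℝ) (k : ℕ) (m : Fin n → ℕ) :
    volume (dyadicCube a l k m) = ENNReal.ofReal (l / 2 ^ k) ^ n := by
  rw [dyadicCube_eq_preimage, (PiLp.volume_preserving_ofLp (Fin n)).measure_preimage
    (MeasurableSet.univ_pi fun i => measurableSet_Ico).nullMeasurableSet, Real.volume_pi_Ico]
  simp

namespace IsDyadicSub

variable {a : Rn n} {l : ℝ} {Q R S : Set (Rn n)}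

theorem measurableSet (h : IsDyadicSub a l Q) : MeasurableSet Q := by
  obtain ⟨k, m, -, rfl⟩ := h
  exact measurableSet_dyadicCube a l k m

theorem volume_ne_zero (hl : 0 < l) (h : IsDyadicSub a l Q) : volume Q ≠ 0 := by
  obtain ⟨k, m, -, rfl⟩ := h
  refine (volume_dyadicCube a l k m).trans_ne (pow_ne_zero _ ?_)
  simp only [ne_eq, ENNReal.ofReal_eq_zero, not_le]
  positivity

theorem volume_ne_top (h : IsDyadicSub a l Q) : volume Q ≠ ∞ := by
  obtain ⟨k, m, -, rfl⟩ := h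
  exact (volume_dyadicCube a l k m).trans_ne (ENNReal.pow_ne_top ENNReal.ofReal_ne_top)

theorem nonempty (hl : 0 < l) (h : IsDyadicSub a l Q) : Q.Nonempty :=
  nonempty_of_measure_ne_zero (h.volume_ne_zero hl)

theorem subset_or_subset_or_disjoint (hl : 0 < l) (hQ : IsDyadicSub a l Q)
    (hR : IsDyadicSub a l R) : Q ⊆ R ∨ R ⊆ Q ∨ Disjoint Q R := by
  by_cases hd : Disjoint Q R
  · exact .inr (.inr hd)
  obtain ⟨x, hxQ, hxR⟩ := Set.not_disjoint_iff.mp hd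
  obtain ⟨k, m, -, rfl⟩ := hQ
  obtain ⟨k', m', -, rfl⟩ := hR
  rcases le_total k k' with h | h
  · exact .inr (.inl (dyadicCube_subset_of_le hl h hxQ hxR))
  · exact .inl (dyadicCube_subset_of_le hl h hxR hxQ)

theorem subset_or_subset (hl : 0 < l) (hS : IsDyadicSub a l S) (hQ : IsDyadicSub a l Q)
    (hR : IsDyadicSub a l R) (hRS : R ⊆ S) (hRQ : R ⊆ Q) : S ⊆ Q ∨ Q ⊆ S := by
  rcases hS.subset_or_subset_or_disjoint hl hQ with h | h | h
  · exact .inl h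
  · exact .inr h
  · obtain ⟨x, hx⟩ := hR.nonempty hl
    exact absurd (hRQ hx) (Set.disjoint_left.mp h (hRS hx))

theorem subset_cube (hl : 0 < l) (h : IsDyadicSub a l Q) : Q ⊆ Cube a l := by
  obtain ⟨k, m, hm, rfl⟩ := h
  intro x hx i
  obtain ⟨h₁, h₂⟩ := hx i
  have hm' : (m i : ℝ) + 1 ≤ 2 ^ k := by exact_mod_cast hm i
  have h₃ : 0 ≤ l * m i / 2 ^ k := by positivity
  have h₄ : l * m i / 2 ^ k + l / 2 ^ k ≤ l := by
    rw [← add_div, div_le_iff₀ (by positivity)]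
    nlinarith
  constructor <;> linarith

/-- Every dyadic cube with a property lies in a maximal dyadic cube with that property. -/
theorem exists_maximal (hl : 0 < l) (p : Set (Rn n) → Prop) (hQ : IsDyadicSub a l Q)
    (hp : p Q) : ∃ T, IsDyadicSub a l T ∧ p T ∧ Q ⊆ T ∧
      ∀ T', IsDyadicSub a l T' → p T' → T ⊆ T' → T' = T := by
  classical
  have hex : ∃ k, ∃ m : Fin n → ℕ, (∀ i, m i < 2 ^ k) ∧ p (dyadicCube a l k m) ∧
      Q ⊆ dyadicCube a l k m := by
    obtain ⟨k, m, hm, rfl⟩ := hQ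
    exact ⟨k, m, hm, hp, subset_rfl⟩
  obtain ⟨m, hm, hpm, hQm⟩ := Nat.find_spec hex
  refine ⟨_, ⟨_, m, hm, rfl⟩, hpm, hQm, ?_⟩
  rintro T' ⟨k', m', hm', rfl⟩ hp' hsub
  have hk : Nat.find hex ≤ k' := Nat.find_min' hex ⟨m', hm', hp', hQm.trans hsub⟩
  obtain ⟨x, hx⟩ := hQ.nonempty hl
  exact (dyadicCube_subset_of_le hl hk (hQm hx) (hsub (hQm hx))).antisymm hsub

end IsDyadicSub

theorem countable_isDyadicSub (a : Rn n) (l : ℝ) : {Q | IsDyadicSub a l Q}.Countable := by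
  refine (countable_range fun p : ℕ × (Fin n → ℕ) => dyadicCube a l p.1 p.2).mono ?_
  rintro Q ⟨k, m, -, rfl⟩
  exact ⟨(k, m), rfl⟩

end Dyadic

/-! ### Stopping cubes -/

section Stopping

variable {n : ℕ} {a : Rn n} {l ρ : ℝ} {f w : Rn n → ℝ} {S T : Set (Rn n)}

/-- The mean oscillation over `T` of `f` around its average on `S`. -/
def meanOsc (f : Rn n → ℝ) (S T : Set (Rn n)) : ℝ :=
  ⨍ x in T, |f x - ⨍ y in S, f y|

/-- `T` is a maximal dyadic subcube of `S` on which the oscillation of `f` around its average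
on `S` exceeds `ρ` times the oscillation on `S`. -/
def IsStoppingCube (a : Rn n) (l ρ : ℝ) (f : Rn n → ℝ) (S T : Set (Rn n)) : Prop :=
  IsDyadicSub a l T ∧ (T ⊆ S ∧ ρ * meanOsc f S S < meanOsc f S T) ∧
    ∀ T', IsDyadicSub a l T' → (T' ⊆ S ∧ ρ * meanOsc f S S < meanOsc f S T') → T ⊆ T' → T' = T

theorem meanOsc_nonneg (f : Rn n → ℝ) (S T : Set (Rn n)) : 0 ≤ meanOsc f S T := by
  rw [meanOsc, setAverage_eq]
  exact smul_nonneg (by positivity) (integral_nonneg fun _ => abs_nonneg _)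

theorem ofReal_meanOsc_mul_volume (hl : 0 < l) (hT : IsDyadicSub a l T)
    (hf : IntegrableOn f T) :
    ENNReal.ofReal (meanOsc f S T) * volume T =
      ∫⁻ x in T, ENNReal.ofReal |f x - ⨍ y in S, f y| := by
  have hint : IntegrableOn (fun x => |f x - ⨍ y in S, f y|) T :=
    (hf.sub (integrableOn_const hT.volume_ne_top)).abs
  rw [← ofReal_integral_eq_lintegral_ofReal hint (ae_of_all _ fun _ => abs_nonneg _),
    ← ofReal_measureReal hT.volume_ne_top, ← ENNReal.ofReal_mul (meanOsc_nonneg f S T),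
    meanOsc, setAverage_eq, smul_eq_mul]
  have : volume.real T ≠ 0 :=
    (ENNReal.toReal_pos (hT.volume_ne_zero hl) hT.volume_ne_top).ne'
  congr 1
  field_simp

theorem IsStoppingCube.ssubset (hρ : 1 < ρ) (h : IsStoppingCube a l ρ f S T) : T ⊂ S := by
  refine h.2.1.1.ssubset_of_ne ?_
  rintro rfl
  nlinarith [h.2.1.2, meanOsc_nonneg f T T]

/-- The stopping cubes of `S` occupy at most the fraction `1 / ρ` of `S`. -/
theorem volume_sUnion_stopping_le (hl : 0 < l) (hρ : 1 < ρ) (hS : IsDyadicSub a l S)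
    (hf : IntegrableOn f S) {𝒯 : Set (Set (Rn n))} (h𝒯 : ∀ T ∈ 𝒯, IsStoppingCube a l ρ f S T)
    (hc : 𝒯.Countable) (hd : 𝒯.Pairwise Disjoint) :
    volume (⋃₀ 𝒯) / volume S ≤ ENNReal.ofReal ρ⁻¹ := by
  rcases 𝒯.eq_empty_or_nonempty with rfl | ⟨T₀, hT₀⟩
  · simp
  have hm : ∀ T ∈ 𝒯, MeasurableSet T := fun T hT => (h𝒯 T hT).1.measurableSet
  have hsub : ⋃₀ 𝒯 ⊆ S := sUnion_subset fun T hT => (h𝒯 T hT).2.1.1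
  set g : Rn n → ℝ≥0∞ := fun x => ENNReal.ofReal |f x - ⨍ y in S, f y|
  have hosc : ∀ T, IsDyadicSub a l T → T ⊆ S →
      ENNReal.ofReal (meanOsc f S T) * volume T = ∫⁻ x in T, g x := fun T hT hTS =>
    ofReal_meanOsc_mul_volume hl hT (hf.mono_set hTS)
  have hA : 0 < meanOsc f S S := by
    refine (meanOsc_nonneg f S S).lt_of_ne' fun h0 => ?_
    have h₁ := hosc S hS subset_rfl
    rw [h0, ENNReal.ofReal_zero, zero_mul] at h₁
    have h₂ := hosc T₀ (h𝒯 T₀ hT₀).1 (h𝒯 T₀ hT₀).2.1.1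
    have h₃ : ∫⁻ x in T₀, g x = 0 :=
      le_antisymm ((lintegral_mono_set (h𝒯 T₀ hT₀).2.1.1).trans h₁.symm.le) zero_le
    rw [h₃, mul_eq_zero, or_iff_left ((h𝒯 T₀ hT₀).1.volume_ne_zero hl),
      ENNReal.ofReal_eq_zero] at h₂
    have := (h𝒯 T₀ hT₀).2.1.2
    rw [h0] at this
    linarith
  have key : ENNReal.ofReal (ρ * meanOsc f S S) * volume (⋃₀ 𝒯) ≤
      ENNReal.ofReal (meanOsc f S S) * volume S := by
    rw [measure_sUnion hc hd hm, ← ENNReal.tsum_mul_left, hosc S hS subset_rfl]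
    calc ∑' T : 𝒯, ENNReal.ofReal (ρ * meanOsc f S S) * volume (T : Set (Rn n))
        ≤ ∑' T : 𝒯, ∫⁻ x in (T : Set (Rn n)), g x := by
          refine ENNReal.tsum_le_tsum fun T => ?_
          rw [← hosc T (h𝒯 T T.2).1 (h𝒯 T T.2).2.1.1]
          gcongr
          exact (h𝒯 T T.2).2.1.2.le
      _ = ∫⁻ x in ⋃₀ 𝒯, g x := by
          rw [sUnion_eq_biUnion, lintegral_biUnion hc hm fun s hs t ht hst => hd hs ht hst]
      _ ≤ ∫⁻ x in S, g x := lintegral_mono_set hsub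
  rw [mul_comm ρ, ENNReal.ofReal_mul hA.le, mul_assoc,
    ENNReal.mul_le_mul_iff_right (by simpa using hA) ENNReal.ofReal_ne_top] at key
  refine ENNReal.div_le_of_le_mul ?_
  rw [ENNReal.ofReal_inv_of_pos (by linarith), mul_comm, ← div_eq_mul_inv,
    ENNReal.le_div_iff_mul_le (.inl (by simpa using zero_lt_one.trans hρ))
      (.inl ENNReal.ofReal_ne_top), mul_comm]
  exact key

theorem wMass_ne_zero (hl : 0 < l) (hw : IntegrableOn w (Cube a l))
    (hpos : ∀ᵐ x, x ∈ Cube a l → 0 < w x) (hS : IsDyadicSub a l S) : wMass w S ≠ 0 := by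
  intro h
  rw [wMass, lintegral_eq_zero_iff'
    (hw.mono_set (hS.subset_cube hl)).aestronglyMeasurable.aemeasurable.ennreal_ofReal,
    Filter.EventuallyEq, ae_restrict_iff' hS.measurableSet] at h
  refine hS.volume_ne_zero hl (measure_eq_zero_iff_ae_notMem.mpr ?_)
  filter_upwards [h, hpos] with x h₁ h₂ hx
  exact (ENNReal.ofReal_eq_zero.mp (h₁ hx)).not_gt (h₂ (hS.subset_cube hl hx))

theorem wMass_ne_top (hl : 0 < l) (hw : IntegrableOn w (Cube a l)) (hS : IsDyadicSub a l S) :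
    wMass w S ≠ ∞ :=
  (hw.mono_set (hS.subset_cube hl)).lintegral_lt_top.ne

end Stopping

/-- the stopping-time construction. Given `f ∈ L¹(Q₀)` and
`w ∈ A_∞^d(Q₀)` with constants `Cw, δw`, there are `ρ = ρ(Cw, δw) > 1` with `Cw ρ^{-δw} < 1`
and a collection `𝒮 ⊆ D(Q₀)` with `Q₀ ∈ 𝒮` such that:
(a) if a dyadic `Q` has `π_𝒮 Q = S`, then `⨍_Q |f − f_S| ≤ ρ ⨍_S |f − f_S|`; and
(b) for every `S ∈ 𝒮`, `Σ_{S' ∈ ch_𝒮(S)} w(S') ≤ Cw ρ^{-δw} w(S) < w(S)`. -/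
theorem sparse_stopping_time_collection
    (Cw δw : ℝ) (hCw : 0 < Cw) (hδw : 0 < δw) :
    ∃ ρ : ℝ, 1 < ρ ∧ Cw * ρ ^ (-δw) < 1 ∧
      ∀ (n : ℕ) (a : Rn n) (l : ℝ), 0 < l →
      ∀ w : Rn n → ℝ, IntegrableOn w (Cube a l) volume →
        (∀ᵐ x ∂(volume : Measure (Rn n)), x ∈ Cube a l → 0 < w x) →
        IsAinftyD a l w Cw δw →
      ∀ f : Rn n → ℝ, IntegrableOn f (Cube a l) volume →
      ∃ 𝒮 : Set (Set (Rn n)),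
        (∀ S ∈ 𝒮, IsDyadicSub a l S) ∧ Cube a l ∈ 𝒮 ∧
        (∀ S ∈ 𝒮, ∀ Q : Set (Rn n), IsDyadicSub a l Q → IsMinimalOver 𝒮 Q S →
          (⨍ x in Q, |f x - ⨍ y in S, f y|) ≤ ρ * ⨍ x in S, |f x - ⨍ y in S, f y|) ∧
        (∀ S ∈ 𝒮,
          (∑' S' : {T : Set (Rn n) // IsSChild 𝒮 S T}, wMass w S'.1) ≤
              ENNReal.ofReal (Cw * ρ ^ (-δw)) * wMass w S ∧
          (∑' S' : {T : Set (Rn n) // IsSChild 𝒮 S T}, wMass w S'.1) < wMass w S) := by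
  obtain ⟨ρ, hC, hρ⟩ : ∃ ρ : ℝ, Cw * ρ ^ (-δw) < 1 ∧ 1 < ρ := by
    have h := (tendsto_rpow_neg_atTop hδw).const_mul Cw
    rw [mul_zero] at h
    exact ((h.eventually_lt_const one_pos).and (Filter.eventually_gt_atTop 1)).exists
  refine ⟨ρ, hρ, hC, fun n a l hl w hw hpos hA f hf => ?_⟩
  set M := IsStoppingCube a l ρ f
  set 𝒮 : Set (Set (Rn n)) := {S | Selected M (Cube a l) S}
  have hMmax : ∀ S T T', M S T → M S T' → T ⊆ T' → T = T' := fun S T T' hT hT' h =>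
    (hT.2.2 T' hT'.1 hT'.2.1 h).symm
  have hdy : ∀ S ∈ 𝒮, IsDyadicSub a l S := fun S hS =>
    hS.mem (D := {Q | IsDyadicSub a l Q}) (isDyadicSub_cube a l) fun _ _ h => h.1
  refine ⟨𝒮, hdy, .base, fun S hS Q hQ hmin => ?_, fun S hS => ?_⟩
  · by_contra! hlt
    obtain ⟨T, hT, hTp, hQT, hTmax⟩ := hQ.exists_maximal hl
      (fun T => T ⊆ S ∧ ρ * meanOsc f S S < meanOsc f S T) ⟨hmin.2.1, hlt⟩
    have hMT : M S T := ⟨hT, hTp, hTmax⟩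
    exact (hMT.ssubset hρ).not_subset (hmin.2.2 T (Selected.step hS hMT) hQT)
  have hSd := hdy S hS
  have hch : ∀ T ∈ {T | IsSChild 𝒮 S T}, M S T := by
    rintro T ⟨hT, hTS, hTmax⟩
    obtain ⟨S', hS', hTS'⟩ := Selected.exists_of_ssubset (D := {Q | IsDyadicSub a l Q})
      (isDyadicSub_cube a l) (fun _ h => h.subset_cube hl) (fun _ _ h => h.1)
      (fun _ _ h => h.ssubset hρ) hMmax
      (fun _ h₁ _ h₂ _ h₃ => h₁.subset_or_subset hl h₂ h₃) hT S hS hTS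
    exact hTmax S' (Selected.step hS hS') hTS' (hS'.ssubset hρ) ▸ hS'
  have hcount : {T | IsSChild 𝒮 S T}.Countable :=
    (countable_isDyadicSub a l).mono fun T hT => (hch T hT).1
  have hdisj : {T | IsSChild 𝒮 S T}.Pairwise Disjoint := by
    intro T hT T' hT' hne
    rcases (hch T hT).1.subset_or_subset_or_disjoint hl (hch T' hT').1 with h | h | h
    · exact absurd (hMmax _ _ _ (hch T hT) (hch T' hT') h) hne
    · exact absurd (hMmax _ _ _ (hch T' hT') (hch T hT) h).symm hne
    · exact h
  have hmeas : ∀ T ∈ {T | IsSChild 𝒮 S T}, MeasurableSet T := fun T hT =>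
    (hch T hT).1.measurableSet
  have hsum : (∑' S' : {T : Set (Rn n) // IsSChild 𝒮 S T}, wMass w S'.1) =
      wMass w (⋃₀ {T | IsSChild 𝒮 S T}) := by
    rw [wMass, sUnion_eq_biUnion,
      lintegral_biUnion hcount hmeas fun s hs t ht hst => hdisj hs ht hst]
    rfl
  have hle : wMass w (⋃₀ {T | IsSChild 𝒮 S T}) ≤
      ENNReal.ofReal (Cw * ρ ^ (-δw)) * wMass w S := by
    refine (hA S hSd _ (MeasurableSet.sUnion hcount hmeas)
      (sUnion_subset fun T hT => hT.2.1.subset)).trans ?_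
    have hρ0 : 0 < ρ := by linarith
    rw [ENNReal.ofReal_mul hCw.le, Real.rpow_neg hρ0.le, ← Real.inv_rpow hρ0.le,
      ← ENNReal.ofReal_rpow_of_pos (inv_pos.mpr hρ0)]
    gcongr
    exact volume_sUnion_stopping_le hl hρ hSd (hf.mono_set (hSd.subset_cube hl)) hch hcount hdisj
  rw [hsum]
  refine ⟨hle, hle.trans_lt ?_⟩
  calc ENNReal.ofReal (Cw * ρ ^ (-δw)) * wMass w S < 1 * wMass w S := by
        rw [ENNReal.mul_lt_mul_iff_left (wMass_ne_zero hl hw hpos hSd) (wMass_ne_top hl hw hSd)]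
        exact ENNReal.ofReal_lt_one.mpr hC
    _ = wMass w S := one_mul _
end
end

section
/- Let Q_0 ⊂ ℝ^n be a cube, w ∈ A_∞^d(Q_0) with constants C_w, δ_w > 0, and f ∈ L^1(Q_0). Then there is a collection S ⊂ D(Q_0) of dyadic cubes satisfying: (a) there are a constant η = η(C_w, δ_w) > 0 and pairwise disjoint measurable sets E_Q ⊂ Q for Q ∈ S with w(E_Q) ≥ η w(Q); and (b) there is a constant C = C(n, C_w, δ_w) > 0 such that for every Lebesgue point x ∈ Q_0 of f, |f(x) − f_{Q_0}| ≤ C Σ_{Q∈S} χ_Q(x) · |Q|^{-1}∫_Q |f(y) − f_Q| dy. -/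
open MeasureTheory ENNReal NNReal Set

noncomputable section

/-- `x` is a Lebesgue point of `f` relative to the dyadic subcubes of `Q₀ = Cube a l`:
the averages `⨍_Q |f − f(x)|` over small dyadic cubes `Q ∋ x` tend to `0`. -/
def IsDyadicLebesguePoint {n : ℕ} (a : Rn n) (l : ℝ) (f : Rn n → ℝ) (x : Rn n) : Prop :=
  ∀ ε : ℝ, 0 < ε → ∃ δ : ℝ, 0 < δ ∧ ∀ Q : Set (Rn n), IsDyadicSub a l Q → x ∈ Q →
    volume Q < ENNReal.ofReal δ → (⨍ y in Q, |f y - f x|) < ε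

/-- The integer coordinates of the generation `k` dyadic cell containing `x`. -/
def dyadicIndex {n : ℕ} (a : Rn n) (l : ℝ) (k : ℕ) (x : Rn n) : Fin n → ℤ :=
  fun i => ⌊(x i - a i) / l * 2 ^ k⌋

/-- The dyadic cell of generation `k` containing `x`, in the grid spanned by `Cube a l`. -/
def dyadicCell {n : ℕ} (a : Rn n) (l : ℝ) (k : ℕ) (x : Rn n) : Set (Rn n) :=
  {y | dyadicIndex a l k y = dyadicIndex a l k x}

section Cells

variable {n : ℕ} {a : Rn n} {l : ℝ} {k j : ℕ} {x y : Rn n}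

theorem mem_dyadicCell_self : x ∈ dyadicCell a l k x := rfl

theorem dyadicCell_eq_of_mem (h : y ∈ dyadicCell a l k x) :
    dyadicCell a l k y = dyadicCell a l k x := by
  ext z
  simp only [dyadicCell, mem_ofPred_eq] at h ⊢
  rw [h]

theorem dyadicCell_succ_subset : dyadicCell a l (k + 1) x ⊆ dyadicCell a l k x := by
  have key : ∀ u : ℝ, ⌊u * 2 ^ k⌋ = ⌊u * 2 ^ (k + 1)⌋ / ((2 : ℕ) : ℤ) := by
    intro u
    rw [← Int.floor_div_natCast]
    congr 1
    push_cast
    ring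
  intro y hy
  funext i
  have h := congrFun hy i
  simp only [dyadicIndex] at h ⊢
  rw [key, key, h]

theorem dyadicCell_antitone : Antitone fun k => dyadicCell a l k x :=
  antitone_nat_of_succ_le fun _ => dyadicCell_succ_subset

theorem dyadicCell_eq_of_mem_of_le (h : y ∈ dyadicCell a l k x) (hjk : j ≤ k) :
    dyadicCell a l j y = dyadicCell a l j x :=
  dyadicCell_eq_of_mem (dyadicCell_antitone hjk h)

theorem dyadicCell_eq_box (hl : 0 < l) : dyadicCell a l k x =
    {y : Rn n | ∀ i, a i + l * dyadicIndex a l k x i / 2 ^ k ≤ y i ∧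
      y i < a i + l * dyadicIndex a l k x i / 2 ^ k + l / 2 ^ k} := by
  ext y
  simp only [dyadicCell, mem_ofPred_eq, funext_iff]
  refine forall_congr' fun i => ?_
  generalize dyadicIndex a l k x i = m
  have h2 : (0 : ℝ) < 2 ^ k := by positivity
  rw [dyadicIndex, Int.floor_eq_iff, div_mul_eq_mul_div, le_div_iff₀ hl, div_lt_iff₀ hl,
    ← le_sub_iff_add_le', div_le_iff₀ h2, add_assoc, ← sub_lt_iff_lt_add', ← add_div,
    lt_div_iff₀ h2]
  constructor <;> rintro ⟨h, h'⟩ <;> constructor <;> linarith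

theorem dyadicCell_eq_preimage (hl : 0 < l) : dyadicCell a l k x =
    WithLp.ofLp ⁻¹' (univ.pi fun i => Ico (a i + l * dyadicIndex a l k x i / 2 ^ k)
      (a i + l * dyadicIndex a l k x i / 2 ^ k + l / 2 ^ k)) := by
  rw [dyadicCell_eq_box hl]
  ext y
  simp

theorem measurableSet_dyadicCell (hl : 0 < l) : MeasurableSet (dyadicCell a l k x) := by
  rw [dyadicCell_eq_preimage hl]
  exact (PiLp.volume_preserving_ofLp (Fin n)).measurable
    (MeasurableSet.univ_pi fun _ => measurableSet_Ico)

theorem volume_dyadicCell (hl : 0 < l) :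
    volume (dyadicCell a l k x) = ENNReal.ofReal ((l / 2 ^ k) ^ n) := by
  rw [dyadicCell_eq_preimage hl, (PiLp.volume_preserving_ofLp (Fin n)).measure_preimage
    (MeasurableSet.univ_pi fun _ => measurableSet_Ico).nullMeasurableSet, Real.volume_pi_Ico]
  simp only [add_sub_cancel_left, Finset.prod_const, Finset.card_univ, Fintype.card_fin]
  rw [ENNReal.ofReal_pow (by positivity)]

theorem volume_real_dyadicCell (hl : 0 < l) :
    volume.real (dyadicCell a l k x) = (l / 2 ^ k) ^ n := by
  rw [Measure.real, volume_dyadicCell hl, ENNReal.toReal_ofReal (by positivity)]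

theorem volume_real_dyadicCell_pos (hl : 0 < l) : 0 < volume.real (dyadicCell a l k x) := by
  rw [volume_real_dyadicCell hl]
  positivity

theorem countable_range_dyadicCell (a : Rn n) (l : ℝ) :
    {Q | ∃ k x, Q = dyadicCell a l k x}.Countable := by
  refine (countable_range fun p : ℕ × (Fin n → ℤ) =>
    {y : Rn n | dyadicIndex a l p.1 y = p.2}).mono ?_
  rintro _ ⟨k, x, rfl⟩
  exact ⟨(k, dyadicIndex a l k x), rfl⟩

theorem mem_Cube_iff_dyadicIndex (hl : 0 < l) : x ∈ Cube a l ↔ dyadicIndex a l 0 x = 0 := by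
  simp only [Cube, mem_ofPred_eq, funext_iff]
  refine forall_congr' fun i => ?_
  rw [dyadicIndex, Pi.zero_apply, Int.floor_eq_iff, pow_zero, mul_one, le_div_iff₀ hl,
    div_lt_iff₀ hl]
  push_cast
  constructor <;> rintro ⟨h, h'⟩ <;> constructor <;> linarith

theorem dyadicCell_zero (hl : 0 < l) (hx : x ∈ Cube a l) : dyadicCell a l 0 x = Cube a l := by
  ext y
  rw [mem_Cube_iff_dyadicIndex hl, dyadicCell, mem_ofPred_eq,
    (mem_Cube_iff_dyadicIndex hl).1 hx]

theorem dyadicCell_subset_Cube (hl : 0 < l) (hx : x ∈ Cube a l) :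
    dyadicCell a l k x ⊆ Cube a l := by
  rw [← dyadicCell_zero hl hx]
  exact dyadicCell_antitone (Nat.zero_le k)

theorem isDyadicSub_dyadicCell (hl : 0 < l) (hx : x ∈ Cube a l) :
    IsDyadicSub a l (dyadicCell a l k x) := by
  have hpos : ∀ i, 0 ≤ dyadicIndex a l k x i := by
    intro i
    have := (hx i).1
    have h0 : 0 ≤ x i - a i := by linarith
    exact Int.floor_nonneg.2 (by positivity)
  have hlt : ∀ i, dyadicIndex a l k x i < 2 ^ k := by
    intro i
    rw [dyadicIndex, Int.floor_lt]
    have := (hx i).2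
    have h1 : (x i - a i) / l < 1 := by
      rw [div_lt_one hl]
      linarith
    push_cast
    exact mul_lt_of_lt_one_left (by positivity) h1
  lift dyadicIndex a l k x to Fin n → ℕ using hpos with m hm
  refine ⟨k, m, fun i => by exact_mod_cast hlt i, ?_⟩
  rw [dyadicCell_eq_box hl, ← hm]
  simp

end Cells

/-- The mean deviation of `f` from the constant `c` over the set `A`. -/
def meanDev {n : ℕ} (f : Rn n → ℝ) (A : Set (Rn n)) (c : ℝ) : ℝ :=
  ⨍ y in A, |f y - c|

section Averages

variable {n : ℕ} {f : Rn n → ℝ} {A B : Set (Rn n)} {c : ℝ}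

theorem meanDev_nonneg : 0 ≤ meanDev f A c := by
  rw [meanDev, setAverage_eq]
  have : 0 ≤ ∫ y in A, |f y - c| := integral_nonneg fun _ => abs_nonneg _
  exact smul_nonneg (by positivity) this

theorem volume_ne_top_of_real_pos (hA : 0 < volume.real A) : volume A ≠ ∞ := by
  intro h
  simp [Measure.real, h] at hA

theorem integrableOn_abs_sub_const (hA : 0 < volume.real A) (hf : IntegrableOn f A) (c : ℝ) :
    IntegrableOn (fun y => |f y - c|) A :=
  (hf.sub (integrableOn_const (volume_ne_top_of_real_pos hA))).abs

theorem abs_setAverage_sub_le_meanDev (hA : 0 < volume.real A) (hf : IntegrableOn f A) (c : ℝ) :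
    |(⨍ y in A, f y) - c| ≤ meanDev f A c := by
  have h : (⨍ y in A, f y) - c = (volume.real A)⁻¹ * ∫ y in A, (f y - c) := by
    rw [integral_sub hf (integrableOn_const (volume_ne_top_of_real_pos hA)), setAverage_eq,
      setIntegral_const, smul_eq_mul, smul_eq_mul]
    field_simp
  rw [h, meanDev, setAverage_eq, abs_mul, abs_of_pos (inv_pos.2 hA), smul_eq_mul]
  gcongr
  exact abs_integral_le_integral_abs

theorem meanDev_le_mul_meanDev {r : ℝ} (hAB : A ⊆ B) (hA : 0 < volume.real A)
    (hB : 0 < volume.real B) (hvol : volume.real B = r * volume.real A) (hf : IntegrableOn f B) :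
    meanDev f A c ≤ r * meanDev f B c := by
  have h := setIntegral_mono_set (integrableOn_abs_sub_const hB hf c)
    (ae_of_all _ fun _ => abs_nonneg _) hAB.eventuallyLE
  have hr : r = volume.real B * (volume.real A)⁻¹ := by
    rw [hvol]
    field_simp
  rw [meanDev, meanDev, setAverage_eq, setAverage_eq, smul_eq_mul, smul_eq_mul, hr]
  calc _ ≤ (volume.real A)⁻¹ * ∫ y in B, |f y - c| := by gcongr
    _ = _ := by field_simp

theorem ofReal_meanDev_mul_volume (hA : 0 < volume.real A) (hf : IntegrableOn f A) (c : ℝ) :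
    ENNReal.ofReal (meanDev f A c) * volume A = ∫⁻ y in A, ENNReal.ofReal |f y - c| := by
  rw [← ofReal_integral_eq_lintegral_ofReal (integrableOn_abs_sub_const hA hf c)
      (ae_of_all _ fun _ => abs_nonneg _),
    ← ENNReal.ofReal_toReal (volume_ne_top_of_real_pos hA), ← ENNReal.ofReal_mul meanDev_nonneg,
    meanDev, setAverage_eq, smul_eq_mul, ← Measure.real]
  congr 1
  field_simp

/-- The weak type estimate for a disjoint family of sets on which the mean deviation is large. -/
theorem ofReal_mul_volume_sUnion_le {𝓜 : Set (Set (Rn n))} {t : ℝ}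
    (hc : 𝓜.Countable) (hd : 𝓜.PairwiseDisjoint id) (hm : ∀ A ∈ 𝓜, MeasurableSet A)
    (hpos : ∀ A ∈ 𝓜, 0 < volume.real A) (hsub : ∀ A ∈ 𝓜, A ⊆ B) (hf : IntegrableOn f B)
    (hbig : ∀ A ∈ 𝓜, t ≤ meanDev f A c) :
    ENNReal.ofReal t * volume (⋃ A ∈ 𝓜, A) ≤ ∫⁻ y in B, ENNReal.ofReal |f y - c| := by
  calc ENNReal.ofReal t * volume (⋃ A ∈ 𝓜, A)
      = ∑' A : 𝓜, ENNReal.ofReal t * volume (A : Set (Rn n)) := by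
        rw [ENNReal.tsum_mul_left]
        exact congrArg _ (measure_biUnion hc hd hm)
    _ ≤ ∑' A : 𝓜, ∫⁻ y in (A : Set (Rn n)), ENNReal.ofReal |f y - c| := by
        refine ENNReal.tsum_le_tsum fun A => ?_
        rw [← ofReal_meanDev_mul_volume (hpos A A.2) (hf.mono_set (hsub A A.2))]
        gcongr
        exact hbig A A.2
    _ = ∫⁻ y in ⋃ A ∈ 𝓜, A, ENNReal.ofReal |f y - c| := (lintegral_biUnion hc hm hd _).symm
    _ ≤ _ := lintegral_mono_set (iUnion₂_subset hsub)

end Averages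

/-- The generation of the stopping cell that is active at generation `k` above `x`: a cell of
generation `k + 1` becomes active when the mean deviation of `f` on it from the average over the
active cell exceeds `Λ` times the oscillation over the active cell. -/
def stopGen {n : ℕ} (a : Rn n) (l : ℝ) (f : Rn n → ℝ) (Λ : ℝ) : ℕ → Rn n → ℕ
  | 0, _ => 0
  | k + 1, x =>
    if Λ * meanDev f (dyadicCell a l (stopGen a l f Λ k x) x)
          (⨍ y in dyadicCell a l (stopGen a l f Λ k x) x, f y) <
        meanDev f (dyadicCell a l (k + 1) x)
          (⨍ y in dyadicCell a l (stopGen a l f Λ k x) x, f y)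
    then k + 1 else stopGen a l f Λ k x

/-- The oscillation of `f` over the generation `k` cell of `x`. -/
def cellOsc {n : ℕ} (a : Rn n) (l : ℝ) (f : Rn n → ℝ) (k : ℕ) (x : Rn n) : ℝ :=
  meanDev f (dyadicCell a l k x) (⨍ y in dyadicCell a l k x, f y)

/-- The stopping cells inside `Cube a l`. -/
def stopCells {n : ℕ} (a : Rn n) (l : ℝ) (f : Rn n → ℝ) (Λ : ℝ) : Set (Set (Rn n)) :=
  {Q | ∃ k, ∃ x ∈ Cube a l, stopGen a l f Λ k x = k ∧ Q = dyadicCell a l k x}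

/-- The part of `Q` that lies in no smaller stopping cell. -/
def stopCore {n : ℕ} (a : Rn n) (l : ℝ) (f : Rn n → ℝ) (Λ : ℝ) (Q : Set (Rn n)) : Set (Rn n) :=
  Q \ ⋃ Q' ∈ {Q' ∈ stopCells a l f Λ | ¬ Q ⊆ Q'}, Q'

section Stopping

variable {n : ℕ} {a : Rn n} {l : ℝ} {f : Rn n → ℝ} {Λ : ℝ} {k j : ℕ} {x y : Rn n}

theorem cellOsc_nonneg : 0 ≤ cellOsc a l f k x := meanDev_nonneg

theorem stopGen_le : stopGen a l f Λ k x ≤ k := by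
  induction k with
  | zero => simp [stopGen]
  | succ k ih =>
    rw [stopGen]
    split_ifs
    · rfl
    · omega

theorem stopGen_succ_eq_of_ne (h : stopGen a l f Λ (k + 1) x ≠ k + 1) :
    stopGen a l f Λ (k + 1) x = stopGen a l f Λ k x := by
  rw [stopGen] at h ⊢
  split_ifs at h ⊢
  · exact absurd rfl h
  · rfl

theorem meanDev_le_of_stopGen_succ_ne (h : stopGen a l f Λ (k + 1) x ≠ k + 1) :
    meanDev f (dyadicCell a l (k + 1) x)
        (⨍ y in dyadicCell a l (stopGen a l f Λ k x) x, f y) ≤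
      Λ * cellOsc a l f (stopGen a l f Λ k x) x := by
  rw [stopGen] at h
  split_ifs at h with hc
  · exact absurd rfl h
  · exact not_lt.1 hc

theorem lt_meanDev_of_stopGen_succ_eq (h : stopGen a l f Λ (k + 1) x = k + 1) :
    Λ * cellOsc a l f (stopGen a l f Λ k x) x < meanDev f (dyadicCell a l (k + 1) x)
        (⨍ y in dyadicCell a l (stopGen a l f Λ k x) x, f y) := by
  rw [stopGen] at h
  split_ifs at h with hc
  · exact hc
  · have := stopGen_le (a := a) (l := l) (f := f) (Λ := Λ) (k := k) (x := x)
    omega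

theorem stopGen_eq_of_mem (h : y ∈ dyadicCell a l k x) (hjk : j ≤ k) :
    stopGen a l f Λ j y = stopGen a l f Λ j x := by
  induction j with
  | zero => rfl
  | succ j ih =>
    have hle := stopGen_le (a := a) (l := l) (f := f) (Λ := Λ) (k := j) (x := x)
    rw [stopGen, stopGen, ih (by omega), dyadicCell_eq_of_mem_of_le h hjk,
      dyadicCell_eq_of_mem_of_le h (hle.trans (by omega))]

theorem meanDev_le_mul_cellOsc (hΛ : 1 ≤ Λ) :
    meanDev f (dyadicCell a l k x) (⨍ y in dyadicCell a l (stopGen a l f Λ k x) x, f y) ≤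
      Λ * cellOsc a l f (stopGen a l f Λ k x) x := by
  by_cases h : stopGen a l f Λ k x = k
  · rw [h]
    exact le_mul_of_one_le_left cellOsc_nonneg hΛ
  · cases k with
    | zero => exact absurd rfl h
    | succ k =>
      rw [stopGen_succ_eq_of_ne h]
      exact meanDev_le_of_stopGen_succ_ne h

theorem le_stopGen (hjk : j ≤ k) (hj : stopGen a l f Λ j x = j) : j ≤ stopGen a l f Λ k x := by
  induction k, hjk using Nat.le_induction with
  | base => exact hj.ge
  | succ k hk ih =>
    by_cases h : stopGen a l f Λ (k + 1) x = k + 1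
    · omega
    · rwa [stopGen_succ_eq_of_ne h]

theorem dyadicCell_ne_of_lt (hΛ : 1 ≤ Λ) (hjk : j < k) (hj : stopGen a l f Λ j x = j)
    (hk : stopGen a l f Λ k x = k) : dyadicCell a l j x ≠ dyadicCell a l k x := by
  intro h
  obtain ⟨k, rfl⟩ : ∃ m, k = m + 1 := ⟨k - 1, by omega⟩
  have hlt := lt_meanDev_of_stopGen_succ_eq hk
  have h1 := le_stopGen (Nat.lt_succ_iff.1 hjk) hj
  have h2 := stopGen_le (a := a) (l := l) (f := f) (Λ := Λ) (k := k) (x := x)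
  have h3 : dyadicCell a l (k + 1) x = dyadicCell a l (stopGen a l f Λ k x) x :=
    (dyadicCell_antitone (by omega)).antisymm ((dyadicCell_antitone h1).trans h.le)
  rw [h3] at hlt
  exact absurd (le_mul_of_one_le_left cellOsc_nonneg hΛ) (not_le.2 hlt)

theorem countable_stopCells : (stopCells a l f Λ).Countable :=
  (countable_range_dyadicCell a l).mono (by
    rintro _ ⟨k, x, -, -, rfl⟩
    exact ⟨k, x, rfl⟩)

theorem measurableSet_of_mem_stopCells (hl : 0 < l) {Q : Set (Rn n)}
    (hQ : Q ∈ stopCells a l f Λ) : MeasurableSet Q := by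
  obtain ⟨k, x, -, -, rfl⟩ := hQ
  exact measurableSet_dyadicCell hl

theorem measurableSet_stopCore (hl : 0 < l) {Q : Set (Rn n)} (hQ : Q ∈ stopCells a l f Λ) :
    MeasurableSet (stopCore a l f Λ Q) :=
  (measurableSet_of_mem_stopCells hl hQ).diff
    (MeasurableSet.biUnion (countable_stopCells.mono (sep_subset _ _))
      fun _ h => measurableSet_of_mem_stopCells hl h.1)

theorem pairwiseDisjoint_stopCore :
    (stopCells a l f Λ).PairwiseDisjoint (stopCore a l f Λ) := by
  intro Q hQ Q' hQ' hne
  refine disjoint_left.2 fun y hy hy' => hne ?_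
  have key : ∀ {A B : Set (Rn n)}, B ∈ stopCells a l f Λ → y ∈ stopCore a l f Λ A →
      y ∈ B → A ⊆ B := by
    intro A B hB hA hyB
    by_contra h
    exact hA.2 (mem_biUnion (x := B) ⟨hB, h⟩ hyB)
  exact (key hQ' hy hy'.1).antisymm (key hQ hy' hy.1)

/-- The maximal stopping cells strictly below the generation `k` cell of `x`. -/
def stopChildren (a : Rn n) (l : ℝ) (f : Rn n → ℝ) (Λ : ℝ) (k : ℕ) (x : Rn n) :
    Set (Set (Rn n)) :=
  {Q | ∃ j, ∃ y ∈ dyadicCell a l k x, k ≤ j ∧ stopGen a l f Λ (j + 1) y = j + 1 ∧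
    (∀ i, k ≤ i → i ≤ j → stopGen a l f Λ i y = k) ∧ Q = dyadicCell a l (j + 1) y}

theorem pairwiseDisjoint_stopChildren : (stopChildren a l f Λ k x).PairwiseDisjoint id := by
  rintro _ ⟨j, y, -, hkj, hj, hjk, rfl⟩ _ ⟨j', y', -, hkj', hj', hjk', rfl⟩ hne
  refine disjoint_left.2 fun z hz hz' => hne ?_
  have key : ∀ {j j' : ℕ} {y y' : Rn n}, z ∈ dyadicCell a l (j + 1) y →
      z ∈ dyadicCell a l (j' + 1) y' → k ≤ j → stopGen a l f Λ (j + 1) y = j + 1 →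
      (∀ i, k ≤ i → i ≤ j' → stopGen a l f Λ i y' = k) → j' ≤ j := by
    intro j j' y y' hz hz' hkj hj hjk'
    by_contra h
    have h1 := hjk' (j + 1) (by omega) (by omega)
    rw [← stopGen_eq_of_mem hz' (by omega), stopGen_eq_of_mem hz le_rfl] at h1
    omega
  obtain rfl : j = j' := le_antisymm (key hz' hz hkj' hj' hjk) (key hz hz' hkj hj hjk')
  exact (dyadicCell_eq_of_mem hz).symm.trans (dyadicCell_eq_of_mem hz')

theorem diff_stopCore_subset (hk : stopGen a l f Λ k x = k) :
    dyadicCell a l k x \ stopCore a l f Λ (dyadicCell a l k x) ⊆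
      ⋃ A ∈ stopChildren a l f Λ k x, A := by
  rintro y ⟨hy, hyc⟩
  simp only [stopCore, mem_sdiff, hy, true_and, not_not, mem_iUnion] at hyc
  obtain ⟨Q', ⟨⟨j, z, -, hj, rfl⟩, hns⟩, hyz⟩ := hyc
  have hkj : k < j := by
    by_contra h
    refine hns ?_
    rw [← dyadicCell_eq_of_mem hyz, ← dyadicCell_eq_of_mem hy]
    exact dyadicCell_antitone (not_lt.1 h)
  have hj' : stopGen a l f Λ j y = j := (stopGen_eq_of_mem hyz le_rfl).trans hj
  have hky : stopGen a l f Λ k y = k := (stopGen_eq_of_mem hy le_rfl).trans hk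
  have hex : ∃ i, k ≤ i ∧ stopGen a l f Λ (i + 1) y = i + 1 :=
    ⟨j - 1, by omega, by rwa [Nat.sub_add_cancel (by omega)]⟩
  classical
  have hfind := Nat.find_spec hex
  refine mem_biUnion (x := dyadicCell a l (Nat.find hex + 1) y)
    ⟨Nat.find hex, y, hy, hfind.1, hfind.2, fun i hki => ?_, rfl⟩ mem_dyadicCell_self
  induction i, hki using Nat.le_induction with
  | base => exact fun _ => hky
  | succ i hi ih =>
    intro hle
    have hmin := Nat.find_min hex (m := i) (by omega)
    rw [stopGen_succ_eq_of_ne fun h => hmin ⟨hi, h⟩]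
    exact ih (by omega)

theorem mul_cellOsc_lt_of_mem_stopChildren {A : Set (Rn n)}
    (hA : A ∈ stopChildren a l f Λ k x) :
    Λ * cellOsc a l f k x < meanDev f A (⨍ y in dyadicCell a l k x, f y) := by
  obtain ⟨j, y, hy, hkj, hj, hjk, rfl⟩ := hA
  have h := lt_meanDev_of_stopGen_succ_eq hj
  rwa [hjk j hkj le_rfl, cellOsc, dyadicCell_eq_of_mem hy] at h

theorem subset_of_mem_stopChildren {A : Set (Rn n)} (hA : A ∈ stopChildren a l f Λ k x) :
    A ⊆ dyadicCell a l k x := by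
  obtain ⟨j, y, hy, hkj, -, -, rfl⟩ := hA
  rw [← dyadicCell_eq_of_mem hy]
  exact dyadicCell_antitone (by omega)

theorem mul_volume_stopChildren_le (hl : 0 < l)
    (hf : IntegrableOn f (dyadicCell a l k x)) :
    ENNReal.ofReal Λ * volume (⋃ A ∈ stopChildren a l f Λ k x, A) ≤
      volume (dyadicCell a l k x) := by
  have hpos : ∀ A ∈ stopChildren a l f Λ k x, 0 < volume.real A := by
    rintro _ ⟨j, y, -, -, -, -, rfl⟩
    exact volume_real_dyadicCell_pos hl
  have hQ := volume_real_dyadicCell_pos (a := a) (k := k) (x := x) hl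
  have hle := ofReal_mul_volume_sUnion_le (B := dyadicCell a l k x)
    (c := ⨍ y in dyadicCell a l k x, f y) (t := Λ * cellOsc a l f k x)
    ((countable_range_dyadicCell a l).mono (by
      rintro _ ⟨j, y, -, -, -, -, rfl⟩
      exact ⟨j + 1, y, rfl⟩)) pairwiseDisjoint_stopChildren
    (by
      rintro _ ⟨j, y, -, -, -, -, rfl⟩
      exact measurableSet_dyadicCell hl) hpos
    (fun A => subset_of_mem_stopChildren) hf
    (fun A hA => (mul_cellOsc_lt_of_mem_stopChildren hA).le)
  rw [← ofReal_meanDev_mul_volume hQ hf] at hle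
  rcases (cellOsc_nonneg (a := a) (l := l) (f := f) (k := k) (x := x)).eq_or_lt with h0 | h0
  · have hempty : stopChildren a l f Λ k x = ∅ := by
      refine eq_empty_of_forall_notMem fun A hA => ?_
      have h1 := mul_cellOsc_lt_of_mem_stopChildren hA
      have h2 := meanDev_le_mul_meanDev (c := ⨍ y in dyadicCell a l k x, f y)
        (subset_of_mem_stopChildren hA) (hpos A hA) hQ
        (div_mul_cancel₀ _ (hpos A hA).ne').symm hf
      rw [← cellOsc, ← h0, mul_zero] at h2
      rw [← h0, mul_zero] at h1
      exact absurd h2 (not_le.2 h1)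
    simp [hempty]
  · rw [← cellOsc, mul_comm Λ, ENNReal.ofReal_mul h0.le, mul_assoc] at hle
    exact (ENNReal.mul_le_mul_iff_right (ENNReal.ofReal_pos.2 h0).ne' ENNReal.ofReal_ne_top).1 hle

end Stopping

section Domination

variable {n : ℕ} {a : Rn n} {l : ℝ} {f w : Rn n → ℝ} {Λ Cw δw : ℝ} {k : ℕ} {x : Rn n}

theorem half_mul_wMass_le_wMass_stopCore (hl : 0 < l) (hδw : 0 < δw) (hCw : 0 < Cw) (hΛ : 1 ≤ Λ)
    (hΛw : 2 * Cw ≤ Λ ^ δw) (hw : IntegrableOn w (Cube a l)) (hA : IsAinftyD a l w Cw δw)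
    (hf : IntegrableOn f (Cube a l)) {Q : Set (Rn n)} (hQ : Q ∈ stopCells a l f Λ) :
    ENNReal.ofReal (1 / 2) * wMass w Q ≤ wMass w (stopCore a l f Λ Q) := by
  have hcore := measurableSet_stopCore hl hQ
  obtain ⟨k, x, hx, hk, rfl⟩ := hQ
  have hsub := dyadicCell_subset_Cube (k := k) hl hx
  set Q := dyadicCell a l k x
  have hQm : MeasurableSet Q := measurableSet_dyadicCell hl
  have hΛ0 : 0 < Λ := by linarith
  have hratio : volume (Q \ stopCore a l f Λ Q) / volume Q ≤ ENNReal.ofReal Λ⁻¹ := by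
    have h1 := mul_volume_stopChildren_le (Λ := Λ) hl (hf.mono_set hsub)
    have h2 := (mul_le_mul_right (measure_mono (μ := volume) (diff_stopCore_subset hk))
      (ENNReal.ofReal Λ)).trans h1
    refine ENNReal.div_le_of_le_mul ?_
    rw [ENNReal.ofReal_inv_of_pos hΛ0, mul_comm, ← div_eq_mul_inv,
      ENNReal.le_div_iff_mul_le (Or.inl (ENNReal.ofReal_pos.2 hΛ0).ne')
        (Or.inl ENNReal.ofReal_ne_top), mul_comm]
    exact h2
  have hconst : ENNReal.ofReal Cw * ENNReal.ofReal Λ⁻¹ ^ δw ≤ ENNReal.ofReal (1 / 2) := by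
    rw [ENNReal.ofReal_rpow_of_pos (inv_pos.2 hΛ0), ← ENNReal.ofReal_mul hCw.le,
      Real.inv_rpow hΛ0.le]
    refine ENNReal.ofReal_le_ofReal ?_
    rw [← div_eq_mul_inv, div_le_iff₀ (by positivity)]
    linarith
  have hdiff : wMass w (Q \ stopCore a l f Λ Q) ≤ ENNReal.ofReal (1 / 2) * wMass w Q := by
    refine (hA Q (isDyadicSub_dyadicCell hl hx) _ (hQm.diff hcore) sdiff_subset).trans ?_
    refine le_trans ?_ (mul_le_mul_left hconst _)
    gcongr
  have hfin : wMass w Q ≠ ∞ := (hw.mono_set hsub).lintegral_lt_top.ne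
  have hsplit : wMass w Q ≤ wMass w (stopCore a l f Λ Q) + wMass w (Q \ stopCore a l f Λ Q) := by
    refine le_trans ?_ (lintegral_union_le _ _ _)
    exact lintegral_mono_set fun y hy => (em (y ∈ stopCore a l f Λ Q)).imp id fun h => ⟨hy, h⟩
  have hhalf : ENNReal.ofReal (1 / 2) * wMass w Q + ENNReal.ofReal (1 / 2) * wMass w Q =
      wMass w Q := by
    rw [← add_mul, ← ENNReal.ofReal_add (by norm_num) (by norm_num)]
    norm_num
  have hne : ENNReal.ofReal (1 / 2) * wMass w Q ≠ ∞ := ENNReal.mul_ne_top ENNReal.ofReal_ne_top hfin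
  refine (ENNReal.add_le_add_iff_right hne).1 ?_
  rw [hhalf]
  exact hsplit.trans (add_le_add_right hdiff _)

theorem abs_setAverage_stop_sub_add_le (hl : 0 < l) (hΛ : 1 ≤ Λ) (hx : x ∈ Cube a l)
    (hf : IntegrableOn f (Cube a l)) (k : ℕ) :
    |(⨍ y in dyadicCell a l (stopGen a l f Λ k x) x, f y) - ⨍ y in Cube a l, f y| +
        2 ^ n * Λ * cellOsc a l f (stopGen a l f Λ k x) x ≤
      2 ^ n * Λ * ∑ j ∈ Finset.range (k + 1) with stopGen a l f Λ j x = j,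
        cellOsc a l f j x := by
  induction k with
  | zero => simp [stopGen, dyadicCell_zero hl hx, Finset.sum_filter]
  | succ k ih =>
    rw [Finset.range_add_one, Finset.filter_insert]
    split_ifs with h
    · rw [Finset.sum_insert (by simp), h, mul_add]
      set p := stopGen a l f Λ k x
      have h1 := abs_setAverage_sub_le_meanDev (volume_real_dyadicCell_pos hl)
        (hf.mono_set (dyadicCell_subset_Cube (k := k + 1) hl hx))
        (⨍ y in dyadicCell a l p x, f y)
      have h2 := meanDev_le_mul_meanDev (r := 2 ^ n) (c := ⨍ y in dyadicCell a l p x, f y)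
        (dyadicCell_succ_subset (a := a) (l := l) (k := k) (x := x))
        (volume_real_dyadicCell_pos hl) (volume_real_dyadicCell_pos hl)
        (by
          rw [volume_real_dyadicCell hl, volume_real_dyadicCell hl, ← mul_pow]
          congr 1
          field_simp
          ring) (hf.mono_set (dyadicCell_subset_Cube hl hx))
      have h3 := mul_le_mul_of_nonneg_left
        (meanDev_le_mul_cellOsc (a := a) (l := l) (f := f) (k := k) (x := x) hΛ)
        (show (0 : ℝ) ≤ 2 ^ n by positivity)
      have h4 := abs_sub_le (⨍ y in dyadicCell a l (k + 1) x, f y)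
        (⨍ y in dyadicCell a l p x, f y) (⨍ y in Cube a l, f y)
      rw [← mul_assoc] at h3
      linarith
    · rwa [stopGen_succ_eq_of_ne h]

theorem abs_setAverage_dyadicCell_sub_le (hl : 0 < l) (hΛ : 1 ≤ Λ) (hx : x ∈ Cube a l)
    (hf : IntegrableOn f (Cube a l)) (k : ℕ) :
    |(⨍ y in dyadicCell a l k x, f y) - ⨍ y in Cube a l, f y| ≤
      2 ^ n * Λ * ∑ j ∈ Finset.range (k + 1) with stopGen a l f Λ j x = j,
        cellOsc a l f j x := by
  have h1 := abs_setAverage_stop_sub_add_le hl hΛ hx hf k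
  set p := stopGen a l f Λ k x
  have h2 := abs_setAverage_sub_le_meanDev (volume_real_dyadicCell_pos hl)
    (hf.mono_set (dyadicCell_subset_Cube (k := k) hl hx)) (⨍ y in dyadicCell a l p x, f y)
  have h3 := meanDev_le_mul_cellOsc (a := a) (l := l) (f := f) (k := k) (x := x) hΛ
  have h4 := abs_sub_le (⨍ y in dyadicCell a l k x, f y)
    (⨍ y in dyadicCell a l p x, f y) (⨍ y in Cube a l, f y)
  have h5 : Λ * cellOsc a l f p x ≤ 2 ^ n * Λ * cellOsc a l f p x := by
    rw [mul_assoc]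
    exact le_mul_of_one_le_left (mul_nonneg (by linarith) cellOsc_nonneg)
      (one_le_pow₀ (by norm_num))
  linarith

theorem ofReal_sum_cellOsc_le_tsum (hΛ : 1 ≤ Λ) (hx : x ∈ Cube a l) (k : ℕ) :
    ENNReal.ofReal (∑ j ∈ Finset.range (k + 1) with stopGen a l f Λ j x = j,
        cellOsc a l f j x) ≤
      ∑' Q : stopCells a l f Λ, Set.indicator (Q : Set (Rn n))
        (fun _ => ENNReal.ofReal (⨍ y in (Q : Set (Rn n)),
          |f y - ⨍ z in (Q : Set (Rn n)), f z|)) x := by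
  rw [ENNReal.ofReal_sum_of_nonneg fun _ _ => cellOsc_nonneg, ← Finset.sum_subtype_eq_sum_filter]
  let e : {j // stopGen a l f Λ j x = j} → stopCells a l f Λ :=
    fun j => ⟨dyadicCell a l j x, j, x, hx, j.2, rfl⟩
  have he : Function.Injective e := by
    intro i j hij
    have hij' : dyadicCell a l i x = dyadicCell a l j x := congrArg Subtype.val hij
    rcases lt_trichotomy (i : ℕ) j with h | h | h
    · exact absurd hij' (dyadicCell_ne_of_lt hΛ h i.2 j.2)
    · exact Subtype.ext h
    · exact absurd hij'.symm (dyadicCell_ne_of_lt hΛ h j.2 i.2)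
  refine le_trans ?_ (ENNReal.tsum_comp_le_tsum_of_injective he _)
  refine le_trans (Finset.sum_le_sum fun j _ => ?_) (ENNReal.sum_le_tsum _)
  rw [indicator_of_mem (show x ∈ (e j : Set (Rn n)) from mem_dyadicCell_self)]
  rfl

theorem tendsto_setAverage_dyadicCell (hl : 0 < l) (hx : x ∈ Cube a l)
    (hf : IntegrableOn f (Cube a l)) (hL : IsDyadicLebesguePoint a l f x) :
    Filter.Tendsto (fun k => ⨍ y in dyadicCell a l k x, f y) Filter.atTop (nhds (f x)) := by
  have hmean : Filter.Tendsto (fun k => meanDev f (dyadicCell a l k x) (f x)) Filter.atTop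
      (nhds 0) := by
    rcases Nat.eq_zero_or_pos n with rfl | hn
    · have : ∀ k, meanDev f (dyadicCell a l k x) (f x) = 0 := by
        intro k
        have h : ∀ y, |f y - f x| = 0 := fun y => by rw [Subsingleton.elim y x]; simp
        simp [meanDev, h]
      simp [this]
    · have hvol : Filter.Tendsto (fun k : ℕ => (l / 2 ^ k) ^ n) Filter.atTop (nhds 0) := by
        have h := (tendsto_const_nhds (x := l)).div_atTop
          (tendsto_pow_atTop_atTop_of_one_lt (one_lt_two (α := ℝ)))
        simpa [hn.ne'] using h.pow n
      rw [Metric.tendsto_atTop]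
      intro ε hε
      obtain ⟨δ, hδ, h⟩ := hL ε hε
      obtain ⟨N, hN⟩ := Filter.eventually_atTop.1 (hvol.eventually_lt_const hδ)
      refine ⟨N, fun k hk => ?_⟩
      rw [Real.dist_eq, sub_zero, abs_of_nonneg meanDev_nonneg]
      refine h _ (isDyadicSub_dyadicCell hl hx) mem_dyadicCell_self ?_
      rw [volume_dyadicCell hl]
      exact (ENNReal.ofReal_lt_ofReal_iff hδ).2 (hN k hk)
  rw [tendsto_iff_dist_tendsto_zero]
  refine squeeze_zero (fun _ => dist_nonneg) (fun k => ?_) hmean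
  rw [Real.dist_eq]
  exact abs_setAverage_sub_le_meanDev (volume_real_dyadicCell_pos hl)
    (hf.mono_set (dyadicCell_subset_Cube hl hx)) _

end Domination

/-- sparse domination lemma: for `w ∈ A_∞^d(Q₀)` and `f ∈ L¹(Q₀)` there is
a collection `𝒮` of dyadic cubes such that (a) `𝒮` is `η`-sparse with respect to `w`, where
`η = η(Cw, δw) > 0`, and (b) at every Lebesgue point `x ∈ Q₀` of `f`,
`|f(x) − f_{Q₀}| ≤ C Σ_{Q∈𝒮} χ_Q(x) ⨍_Q |f − f_Q|` with `C = C(n, Cw, δw)`. -/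
theorem sparse_domination_of_oscillation
    (Cw δw : ℝ) (hCw : 0 < Cw) (hδw : 0 < δw) :
    ∃ η : ℝ, 0 < η ∧ ∀ n : ℕ, ∃ C : ℝ, 0 < C ∧
      ∀ (a : Rn n) (l : ℝ), 0 < l →
      ∀ w : Rn n → ℝ, IntegrableOn w (Cube a l) volume →
        (∀ᵐ x ∂(volume : Measure (Rn n)), x ∈ Cube a l → 0 < w x) →
        IsAinftyD a l w Cw δw →
      ∀ f : Rn n → ℝ, IntegrableOn f (Cube a l) volume →
      ∃ 𝒮 : Set (Set (Rn n)),
        (∀ S ∈ 𝒮, IsDyadicSub a l S) ∧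
        (∃ E : Set (Rn n) → Set (Rn n),
          (∀ Q ∈ 𝒮, MeasurableSet (E Q) ∧ E Q ⊆ Q ∧
            ENNReal.ofReal η * wMass w Q ≤ wMass w (E Q)) ∧
          𝒮.PairwiseDisjoint E) ∧
        (∀ x ∈ Cube a l, IsDyadicLebesguePoint a l f x →
          ENNReal.ofReal |f x - ⨍ y in Cube a l, f y| ≤
            ENNReal.ofReal C *
              ∑' Q : 𝒮, Set.indicator (Q : Set (Rn n))
                (fun _ => ENNReal.ofReal (⨍ y in (Q : Set (Rn n)), |f y - ⨍ z in (Q : Set (Rn n)), f z|)) x) := by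
  obtain ⟨Λ, hΛ, hΛw⟩ : ∃ Λ : ℝ, 1 ≤ Λ ∧ 2 * Cw ≤ Λ ^ δw :=
    ((Filter.eventually_ge_atTop 1).and
      ((_root_.tendsto_rpow_atTop hδw).eventually_ge_atTop (2 * Cw))).exists
  refine ⟨1 / 2, by norm_num, fun n => ⟨2 ^ n * Λ, by positivity, ?_⟩⟩
  intro a l hl w hw _ hA f hf
  refine ⟨stopCells a l f Λ, ?_, ⟨stopCore a l f Λ, fun Q hQ => ⟨measurableSet_stopCore hl hQ,
    sdiff_subset, half_mul_wMass_le_wMass_stopCore hl hδw hCw hΛ hΛw hw hA hf hQ⟩,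
    pairwiseDisjoint_stopCore⟩, fun x hx hL => ?_⟩
  · rintro _ ⟨k, x, hx, -, rfl⟩
    exact isDyadicSub_dyadicCell hl hx
  · have hlim := ENNReal.tendsto_ofReal
      ((tendsto_setAverage_dyadicCell hl hx hf hL).sub_const (⨍ y in Cube a l, f y)).abs
    refine le_of_tendsto' hlim fun k => ?_
    refine (ENNReal.ofReal_le_ofReal
      (abs_setAverage_dyadicCell_sub_le hl hΛ hx hf k)).trans ?_
    rw [ENNReal.ofReal_mul (by positivity)]
    gcongr
    exact ofReal_sum_cellOsc_le_tsum hΛ hx k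
end
end
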